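/- (Gagliardo–Nirenberg product estimate) Let u₁,…,u_l ∈ C^m(ℝ²₊) ∩ L^∞ with all derivatives up to order m in L², and let α₁,…,α_l be multi-indices with |α₁| + ⋯ + |α_l| = m. Then ‖∂^{α₁}u₁ ⋯ ∂^{α_l}u_l‖_{L²(ℝ²₊)} ≤ C Σ_{j=1}^l ( Π_{i≠j} ‖u_i‖_{L^∞(ℝ²₊)} ) ‖u_j‖_{H^m(ℝ²₊)}, where C depends only on l and m. -/

import Mathlib

open Set MeasureTheory

noncomputable def pd (s t : ℕ) (u : ℝ × ℝ → ℝ) : ℝ × ℝ → ℝ := fun q =>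
  iteratedDeriv s (fun x => iteratedDeriv t (fun y => u (x, y)) q.2) q.1

noncomputable def sobNormSq (m : ℕ) (S : Set (ℝ × ℝ)) (u : ℝ × ℝ → ℝ) : ℝ :=
  ∑ s ∈ Finset.range (m + 1), ∑ t ∈ Finset.range (m + 1),
    if s + t ≤ m then ∫ q in S, (pd s t u q) ^ 2 else 0

def halfPlane : Set (ℝ × ℝ) := {q | 0 ≤ q.1}

open scoped ENNReal

lemma hasDerivAt_mul_abs_rpow {a : ℝ} (ha : 0 ≤ a) (t : ℝ) :
    HasDerivAt (fun t : ℝ => t * |t| ^ a) ((a + 1) * |t| ^ a) t := by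
  rcases eq_or_ne t 0 with rfl | ht
  · rcases ha.eq_or_lt with rfl | ha
    · simpa using hasDerivAt_id' (0 : ℝ)
    · rw [hasDerivAt_iff_tendsto_slope, abs_zero, Real.zero_rpow ha.ne', mul_zero]
      have hc : ContinuousAt (fun x : ℝ => |x| ^ a) 0 :=
        (continuous_abs.rpow_const fun _ => Or.inr ha.le).continuousAt
      have hc' : Filter.Tendsto (fun x : ℝ => |x| ^ a) (nhdsWithin 0 {0}ᶜ) (nhds 0) := by
        simpa [ContinuousAt, Real.zero_rpow ha.ne'] using hc.tendsto.mono_left nhdsWithin_le_nhds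
      refine hc'.congr' ?_
      filter_upwards [self_mem_nhdsWithin] with x hx
      have hx : x ≠ 0 := hx
      simp [slope_def_field, field]
  · have h := (hasDerivAt_id t).mul ((hasDerivAt_abs ht).rpow_const (p := a)
      (Or.inl (abs_ne_zero.mpr ht)))
    refine h.congr_deriv ?_
    have h0 : 0 < |t| := abs_pos.mpr ht
    rw [Real.rpow_sub_one h0.ne']
    have hs : t * (SignType.sign t : ℝ) = |t| := by
      simp
    simp only [id]
    field_simp
    linear_combination a * hs

lemma abs_rpow_eq {p : ℝ} (hp : 2 ≤ p) (t : ℝ) : |t| ^ p = t * (t * |t| ^ (p - 2)) := by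
  rcases eq_or_ne t 0 with rfl | ht
  · simp [Real.zero_rpow (by linarith : p ≠ 0)]
  · have h0 : 0 < |t| := abs_pos.mpr ht
    rw [← mul_assoc, ← abs_mul_abs_self, ← sq, ← Real.rpow_natCast, ← Real.rpow_add h0]
    simp

section
variable {f f₁ f₂ : ℝ → ℝ} {p : ℝ}

lemma hasDerivAt_mul_mul_abs_rpow (hp : 2 ≤ p) (h₁ : ∀ x, HasDerivAt f (f₁ x) x)
    (h₂ : ∀ x, HasDerivAt f₁ (f₂ x) x) (x : ℝ) :
    HasDerivAt (fun x => f x * (f₁ x * |f₁ x| ^ (p - 2)))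
      (|f₁ x| ^ p + (p - 1) * (f x * |f₁ x| ^ (p - 2) * f₂ x)) x := by
  have h := (h₁ x).mul ((hasDerivAt_mul_abs_rpow (sub_nonneg.mpr hp) (f₁ x)).comp x (h₂ x))
  refine h.congr_deriv ?_
  rw [abs_rpow_eq hp]
  simp only [Function.comp]
  ring

lemma hasCompactSupport_of_hasDerivAt (h₁ : ∀ x, HasDerivAt f (f₁ x) x)
    (hs : HasCompactSupport f) : HasCompactSupport f₁ := by
  have : f₁ = deriv f := funext fun x => (h₁ x).deriv.symm
  exact this ▸ hs.deriv

lemma continuous_of_hasDerivAt (h₁ : ∀ x, HasDerivAt f (f₁ x) x) : Continuous f :=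
  continuous_iff_continuousAt.mpr fun x => (h₁ x).continuousAt

lemma continuous_abs_rpow_comp {X : Type*} [TopologicalSpace X] {g : X → ℝ} (hg : Continuous g)
    {a : ℝ} (ha : 0 ≤ a) : Continuous fun x => |g x| ^ a :=
  hg.abs.rpow_const fun _ => Or.inr ha

lemma integrable_abs_rpow (hp : 2 ≤ p) (h₁ : ∀ x, HasDerivAt f (f₁ x) x)
    (h₂ : ∀ x, HasDerivAt f₁ (f₂ x) x) (hs : HasCompactSupport f) :
    Integrable fun x => |f₁ x| ^ p := by
  refine (continuous_abs_rpow_comp (continuous_of_hasDerivAt h₂)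
    (by linarith)).integrable_of_hasCompactSupport ?_
  exact (hasCompactSupport_of_hasDerivAt h₁ hs).comp_left (g := fun t : ℝ => |t| ^ p)
    (by simp [Real.zero_rpow (by linarith : p ≠ 0)])

lemma integrable_mul_abs_rpow_mul (hp : 2 ≤ p) (h₁ : ∀ x, HasDerivAt f (f₁ x) x)
    (h₂ : ∀ x, HasDerivAt f₁ (f₂ x) x) (c₂ : Continuous f₂) (hs : HasCompactSupport f) :
    Integrable fun x => f x * |f₁ x| ^ (p - 2) * f₂ x := by
  refine Continuous.integrable_of_hasCompactSupport ?_ (hs.mul_right.mul_right)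
  exact ((continuous_of_hasDerivAt h₁).mul (continuous_abs_rpow_comp (continuous_of_hasDerivAt h₂)
    (by linarith))).mul c₂

lemma integral_Ioi_abs_rpow (hp : 2 ≤ p) (h₁ : ∀ x, HasDerivAt f (f₁ x) x)
    (h₂ : ∀ x, HasDerivAt f₁ (f₂ x) x) (c₂ : Continuous f₂) (hs : HasCompactSupport f) :
    ∫ x in Ioi 0, |f₁ x| ^ p = - (f 0 * (f₁ 0 * |f₁ 0| ^ (p - 2)))
      - (p - 1) * ∫ x in Ioi 0, f x * |f₁ x| ^ (p - 2) * f₂ x := by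
  have i₁ := integrable_abs_rpow hp h₁ h₂ hs
  have i₂ := (integrable_mul_abs_rpow_mul hp h₁ h₂ c₂ hs).const_mul (p - 1)
  have hc : HasCompactSupport (fun x => f x * (f₁ x * |f₁ x| ^ (p - 2))) := hs.mul_right
  have ht := integral_Ioi_of_hasDerivAt_of_tendsto' (a := 0) (m := 0)
    (fun x _ => hasDerivAt_mul_mul_abs_rpow hp h₁ h₂ x) (i₁.add i₂).integrableOn (by
      rw [hasCompactSupport_iff_eventuallyEq, Filter.coclosedCompact_eq_cocompact] at hc
      exact (hc.filter_mono atTop_le_cocompact).tendsto)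
  rw [integral_add i₁.integrableOn i₂.integrableOn, integral_const_mul] at ht
  linarith

lemma integral_abs_rpow (hp : 2 ≤ p) (h₁ : ∀ x, HasDerivAt f (f₁ x) x)
    (h₂ : ∀ x, HasDerivAt f₁ (f₂ x) x) (c₂ : Continuous f₂) (hs : HasCompactSupport f) :
    ∫ x, |f₁ x| ^ p = - ((p - 1) * ∫ x, f x * |f₁ x| ^ (p - 2) * f₂ x) := by
  have i₁ := integrable_abs_rpow hp h₁ h₂ hs
  have i₂ := (integrable_mul_abs_rpow_mul hp h₁ h₂ c₂ hs).const_mul (p - 1)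
  have hc : HasCompactSupport (fun x => f x * (f₁ x * |f₁ x| ^ (p - 2))) := hs.mul_right
  have hcont := continuous_of_hasDerivAt (hasDerivAt_mul_mul_abs_rpow hp h₁ h₂)
  have ht := integral_eq_zero_of_hasDerivAt_of_integrable
    (hasDerivAt_mul_mul_abs_rpow hp h₁ h₂) (i₁.add i₂)
    (hcont.integrable_of_hasCompactSupport hc)
  rw [integral_add i₁ i₂, integral_const_mul] at ht
  linarith

lemma enorm_rpow_eq_ofReal {a : ℝ} (ha : 0 ≤ a) (t : ℝ) :
    ‖t‖ₑ ^ a = ENNReal.ofReal (|t| ^ a) := by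
  rw [Real.enorm_eq_ofReal_abs, ENNReal.ofReal_rpow_of_nonneg (abs_nonneg _) ha]

lemma lintegral_enorm_rpow_eq {μ : Measure ℝ} (hp : 0 ≤ p)
    (hf : Integrable (fun x => |f x| ^ p) μ) :
    ∫⁻ x, ‖f x‖ₑ ^ p ∂μ = ENNReal.ofReal (∫ x, |f x| ^ p ∂μ) := by
  rw [ofReal_integral_eq_lintegral_ofReal hf
    (.of_forall fun x => Real.rpow_nonneg (abs_nonneg _) _)]
  simp_rw [enorm_rpow_eq_ofReal hp]

lemma ofReal_neg_integral_le {μ : Measure ℝ} (hp : 2 ≤ p) :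
    ENNReal.ofReal (-∫ x, f x * |f₁ x| ^ (p - 2) * f₂ x ∂μ) ≤
      ∫⁻ x, ‖f x‖ₑ * ‖f₁ x‖ₑ ^ (p - 2) * ‖f₂ x‖ₑ ∂μ := by
  calc _ ≤ ‖∫ x, f x * |f₁ x| ^ (p - 2) * f₂ x ∂μ‖ₑ := by
        rw [Real.enorm_eq_ofReal_abs]
        exact ENNReal.ofReal_le_ofReal (neg_le_abs _)
    _ ≤ ∫⁻ x, ‖f x * |f₁ x| ^ (p - 2) * f₂ x‖ₑ ∂μ := enorm_integral_le_lintegral_enorm _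
    _ = _ := by
        refine lintegral_congr fun x => ?_
        rw [enorm_mul, enorm_mul, enorm_rpow_eq_ofReal (by linarith),
          Real.enorm_of_nonneg (r := |f₁ x| ^ (p - 2)) (by positivity)]

/-- Gagliardo–Nirenberg type integration by parts on the line. -/
lemma lintegral_enorm_deriv_rpow_le (hp : 2 ≤ p) (h₁ : ∀ x, HasDerivAt f (f₁ x) x)
    (h₂ : ∀ x, HasDerivAt f₁ (f₂ x) x) (c₂ : Continuous f₂) (hs : HasCompactSupport f) :
    ∫⁻ x, ‖f₁ x‖ₑ ^ p ≤ ENNReal.ofReal (p - 1) *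
      ∫⁻ x, ‖f x‖ₑ * ‖f₁ x‖ₑ ^ (p - 2) * ‖f₂ x‖ₑ := by
  rw [lintegral_enorm_rpow_eq (by linarith) (integrable_abs_rpow hp h₁ h₂ hs),
    integral_abs_rpow hp h₁ h₂ c₂ hs, ← mul_neg, ENNReal.ofReal_mul (by linarith)]
  gcongr
  exact ofReal_neg_integral_le hp

/-- Gagliardo–Nirenberg type integration by parts on the half-line. The boundary term is cancelled
by the one of the dilated combination `3 f (x) - 2 f (2 x)`, which is the `C¹` reflection of `f`. -/
lemma lintegral_Ioi_enorm_deriv_rpow_le (hp : 2 ≤ p) (h₁ : ∀ x, HasDerivAt f (f₁ x) x)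
    (h₂ : ∀ x, HasDerivAt f₁ (f₂ x) x) (c₂ : Continuous f₂) (hs : HasCompactSupport f) :
    ∫⁻ x in Ioi 0, ‖f₁ x‖ₑ ^ p ≤ ENNReal.ofReal (p - 1) *
      ((∫⁻ x in Ioi 0, ‖f x‖ₑ * ‖f₁ x‖ₑ ^ (p - 2) * ‖f₂ x‖ₑ) +
        ∫⁻ x in Ioi 0, ‖3 * f x - 2 * f (2 * x)‖ₑ * ‖3 * f₁ x - 4 * f₁ (2 * x)‖ₑ ^ (p - 2) *
          ‖3 * f₂ x - 8 * f₂ (2 * x)‖ₑ) := by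
  have hd : ∀ {u u' : ℝ → ℝ} (a b : ℝ), (∀ x, HasDerivAt u (u' x) x) → ∀ x,
      HasDerivAt (fun x => a * u x - b * u (2 * x)) (a * u' x - 2 * b * u' (2 * x)) x := by
    intro u u' a b h x
    have hm : HasDerivAt (fun x : ℝ => 2 * x) 2 x := by simpa using (hasDerivAt_id x).const_mul 2
    refine (((h x).const_mul a).sub (((h (2 * x)).comp x hm).const_mul b)).congr_deriv ?_
    ring
  have g₁ : ∀ x, HasDerivAt (fun x => 3 * f x - 2 * f (2 * x)) (3 * f₁ x - 4 * f₁ (2 * x)) x := by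
    convert hd 3 2 h₁ using 3; norm_num
  have g₂ : ∀ x, HasDerivAt (fun x => 3 * f₁ x - 4 * f₁ (2 * x)) (3 * f₂ x - 8 * f₂ (2 * x)) x := by
    convert hd 3 4 h₂ using 3; norm_num
  have gc : Continuous fun x => 3 * f₂ x - 8 * f₂ (2 * x) := by fun_prop
  have gs : HasCompactSupport fun x => 3 * f x - 2 * f (2 * x) := by
    have := hs.comp_homeomorph (Homeomorph.mulLeft₀ (2 : ℝ) two_ne_zero)
    exact hs.mul_left.sub this.mul_left
  have ef := integral_Ioi_abs_rpow hp h₁ h₂ c₂ hs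
  have eg := integral_Ioi_abs_rpow hp g₁ g₂ gc gs
  have hpos : 0 ≤ ∫ x in Ioi 0, |3 * f₁ x - 4 * f₁ (2 * x)| ^ p :=
    integral_nonneg fun x => by positivity
  have e0 : 3 * f₁ 0 - 4 * f₁ (2 * 0) = - f₁ 0 := by norm_num; ring
  have e0' : 3 * f 0 - 2 * f (2 * 0) = f 0 := by norm_num; ring
  rw [e0, e0', abs_neg] at eg
  have key : ∫ x in Ioi 0, |f₁ x| ^ p ≤ (p - 1) * (-(∫ x in Ioi 0, f x * |f₁ x| ^ (p - 2) * f₂ x) +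
      -∫ x in Ioi 0, (3 * f x - 2 * f (2 * x)) * |3 * f₁ x - 4 * f₁ (2 * x)| ^ (p - 2) *
        (3 * f₂ x - 8 * f₂ (2 * x))) := by
    linarith
  rw [lintegral_enorm_rpow_eq (by linarith) (integrable_abs_rpow hp h₁ h₂ hs).integrableOn]
  refine (ENNReal.ofReal_le_ofReal key).trans ?_
  rw [ENNReal.ofReal_mul (by linarith)]
  gcongr
  refine ENNReal.ofReal_add_le.trans (add_le_add ?_ ?_) <;>
    exact ofReal_neg_integral_le hp

end

section
variable {X : Type*} [MeasurableSpace X] {μ : Measure X}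

lemma eLpNorm_ofReal_rpow {p : ℝ} (hp : 0 < p) (f : X → ℝ) :
    eLpNorm f (ENNReal.ofReal p) μ ^ p = ∫⁻ x, ‖f x‖ₑ ^ p ∂μ := by
  rw [eLpNorm_eq_lintegral_rpow_enorm_toReal (by simpa) (by simp), ENNReal.toReal_ofReal hp.le,
    ← ENNReal.rpow_mul, one_div_mul_cancel hp.ne', ENNReal.rpow_one]

lemma lintegral_enorm_mul_rpow_mul_le {p : ℝ} (hp : 2 ≤ p) {r s : ℝ≥0∞}
    (hrs : r⁻¹ + s⁻¹ = (ENNReal.ofReal (p / 2))⁻¹) {v w z : X → ℝ}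
    (hv : AEStronglyMeasurable v μ) (hw : AEStronglyMeasurable w μ)
    (hz : AEStronglyMeasurable z μ) :
    ∫⁻ x, ‖v x‖ₑ * ‖w x‖ₑ ^ (p - 2) * ‖z x‖ₑ ∂μ ≤
      eLpNorm v r μ * eLpNorm z s μ * eLpNorm w (ENNReal.ofReal p) μ ^ (p - 2) := by
  have hp0 : 0 < p := by linarith
  have hvz : eLpNorm (v • z) (ENNReal.ofReal (p / 2)) μ ≤ eLpNorm v r μ * eLpNorm z s μ :=
    eLpNorm_smul_le_mul_eLpNorm (hpqr := ⟨hrs⟩) hz hv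
  have h := ENNReal.lintegral_mul_norm_pow_le (μ := μ) (f := fun x => ‖v x * z x‖ₑ ^ (p / 2))
    (g := fun x => ‖w x‖ₑ ^ p) (p := 2 / p) (q := 1 - 2 / p)
    ((hv.mul hz).enorm.pow_const _) (hw.enorm.pow_const _) (by positivity)
    (by rw [sub_nonneg, div_le_one hp0]; exact hp) (by ring)
  have e1 : (∫⁻ x, ‖v x * z x‖ₑ ^ (p / 2) ∂μ) ^ (2 / p) =
      eLpNorm (v • z) (ENNReal.ofReal (p / 2)) μ := by
    have := eLpNorm_ofReal_rpow (μ := μ) (half_pos hp0) (v • z)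
    simp only [Pi.smul_apply', smul_eq_mul] at this
    rw [← this, ← ENNReal.rpow_mul]
    simp [show p / 2 * (2 / p) = 1 by field_simp]
  have e2 : (∫⁻ x, ‖w x‖ₑ ^ p ∂μ) ^ (1 - 2 / p) = eLpNorm w (ENNReal.ofReal p) μ ^ (p - 2) := by
    rw [← eLpNorm_ofReal_rpow hp0, ← ENNReal.rpow_mul]
    congr 1
    field_simp
  rw [e1, e2] at h
  refine (le_of_eq ?_).trans (h.trans (by gcongr))
  refine lintegral_congr fun x => ?_
  rw [← ENNReal.rpow_mul, ← ENNReal.rpow_mul, show p / 2 * (2 / p) = 1 by field_simp,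
    show p * (1 - 2 / p) = p - 2 by field_simp, ENNReal.rpow_one, enorm_mul]
  ring

lemma eLpNorm_sq_le_of_lintegral_le {p : ℝ} (hp : 2 ≤ p) {r s K c : ℝ≥0∞}
    (hrs : r⁻¹ + s⁻¹ = (ENNReal.ofReal (p / 2))⁻¹) {v w z g g₁ g₂ : X → ℝ}
    (hv : AEStronglyMeasurable v μ) (hw : AEStronglyMeasurable w μ)
    (hz : AEStronglyMeasurable z μ) (hg : AEStronglyMeasurable g μ)
    (hg₁ : AEStronglyMeasurable g₁ μ) (hg₂ : AEStronglyMeasurable g₂ μ)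
    (hfin : eLpNorm w (ENNReal.ofReal p) μ ≠ ∞)
    (bg : eLpNorm g r μ ≤ c * eLpNorm v r μ)
    (bg₁ : eLpNorm g₁ (ENNReal.ofReal p) μ ≤ c * eLpNorm w (ENNReal.ofReal p) μ)
    (bg₂ : eLpNorm g₂ s μ ≤ c * eLpNorm z s μ)
    (h : ∫⁻ x, ‖w x‖ₑ ^ p ∂μ ≤ K * ((∫⁻ x, ‖v x‖ₑ * ‖w x‖ₑ ^ (p - 2) * ‖z x‖ₑ ∂μ) +
      ∫⁻ x, ‖g x‖ₑ * ‖g₁ x‖ₑ ^ (p - 2) * ‖g₂ x‖ₑ ∂μ)) :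
    eLpNorm w (ENNReal.ofReal p) μ ^ 2 ≤
      K * (1 + c * c * c ^ (p - 2)) * (eLpNorm v r μ * eLpNorm z s μ) := by
  have hp0 : 0 < p := by linarith
  have h1 := lintegral_enorm_mul_rpow_mul_le hp hrs hv hw hz
  have h2 := lintegral_enorm_mul_rpow_mul_le hp hrs hg hg₁ hg₂
  rw [← eLpNorm_ofReal_rpow hp0] at h
  set W := eLpNorm w (ENNReal.ofReal p) μ
  rcases eq_or_ne W 0 with hW | hW
  · simp [hW]
  have h3 : W ^ 2 * W ^ (p - 2) ≤
      K * (1 + c * c * c ^ (p - 2)) * (eLpNorm v r μ * eLpNorm z s μ) * W ^ (p - 2) := by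
    calc W ^ 2 * W ^ (p - 2) = W ^ p := by
          rw [← ENNReal.rpow_natCast, ← ENNReal.rpow_add _ _ hW hfin]
          simp
      _ ≤ _ := h
      _ ≤ K * (eLpNorm v r μ * eLpNorm z s μ * W ^ (p - 2) +
          (c * eLpNorm v r μ) * (c * eLpNorm z s μ) * (c * W) ^ (p - 2)) := by
        gcongr
        refine h2.trans ?_
        gcongr
      _ = _ := by
        rw [ENNReal.mul_rpow_of_nonneg _ _ (by linarith)]
        ring
  exact (ENNReal.mul_le_mul_iff_left (by simp [hW, hfin])
    (ENNReal.rpow_ne_top_of_nonneg (by linarith) hfin)).mp h3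

end

/-- Lebesgue measure on the half-plane, as a product measure. -/
noncomputable def halfPlaneMeasure : Measure (ℝ × ℝ) :=
  (volume.restrict (Ioi (0 : ℝ))).prod volume

lemma map_two_mul_restrict_Ioi_le :
    (volume.restrict (Ioi (0 : ℝ))).map (fun x => 2 * x) ≤ volume.restrict (Ioi (0 : ℝ)) := by
  have hpre : (fun x : ℝ => 2 * x) ⁻¹' Ioi 0 = Ioi 0 := by ext x; simp
  have := Measure.restrict_map (μ := (volume : Measure ℝ)) (f := fun x : ℝ => 2 * x)
    (by fun_prop) (measurableSet_Ioi (a := (0 : ℝ)))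
  rw [hpre, Real.map_volume_mul_left two_ne_zero] at this
  rw [← this, Measure.restrict_smul]
  refine Measure.le_iff.mpr fun s _ => ?_
  rw [Measure.smul_apply, smul_eq_mul]
  refine mul_le_of_le_one_left' ?_
  rw [ENNReal.ofReal_le_one, abs_of_pos (by norm_num)]
  norm_num

lemma eLpNorm_comp_dilation_le {v : ℝ × ℝ → ℝ} (hv : Continuous v) (r : ℝ≥0∞) :
    eLpNorm (fun q : ℝ × ℝ => v (2 * q.1, q.2)) r halfPlaneMeasure ≤
      eLpNorm v r halfPlaneMeasure := by
  have hm : Measurable (Prod.map (fun x : ℝ => 2 * x) (id : ℝ → ℝ)) := by fun_prop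
  have e := eLpNorm_map_measure (μ := halfPlaneMeasure) (p := r)
    (f := Prod.map (fun x : ℝ => 2 * x) id)
    (g := v) hv.aestronglyMeasurable hm.aemeasurable
  change eLpNorm (v ∘ Prod.map (fun x : ℝ => 2 * x) id) r halfPlaneMeasure ≤ _
  rw [← e]
  refine eLpNorm_mono_measure _ ?_
  rw [halfPlaneMeasure, ← Measure.map_prod_map _ _ (by fun_prop) measurable_id, Measure.map_id]
  exact Measure.prod_mono map_two_mul_restrict_Ioi_le le_rfl

lemma eLpNorm_sub_dilation_le {v : ℝ × ℝ → ℝ} (hv : Continuous v) {r : ℝ≥0∞} (hr : 1 ≤ r)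
    {a b : ℝ} (ha : 0 ≤ a) (hb : 0 ≤ b) (hab : a + b ≤ 11) :
    eLpNorm (fun q : ℝ × ℝ => a * v q - b * v (2 * q.1, q.2)) r halfPlaneMeasure ≤
      11 * eLpNorm v r halfPlaneMeasure := by
  have h1 : Continuous fun q : ℝ × ℝ => v (2 * q.1, q.2) := by fun_prop
  calc _ ≤ eLpNorm (a • v) r halfPlaneMeasure +
        eLpNorm (b • fun q : ℝ × ℝ => v (2 * q.1, q.2)) r halfPlaneMeasure :=
        eLpNorm_sub_le (hv.const_smul a).aestronglyMeasurable
          (h1.const_smul b).aestronglyMeasurable hr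
    _ ≤ ENNReal.ofReal a * eLpNorm v r halfPlaneMeasure +
        ENNReal.ofReal b * eLpNorm v r halfPlaneMeasure := by
        rw [eLpNorm_const_smul, eLpNorm_const_smul, Real.enorm_of_nonneg ha,
          Real.enorm_of_nonneg hb]
        gcongr
        exact eLpNorm_comp_dilation_le hv r
    _ ≤ _ := by
        rw [← add_mul, ← ENNReal.ofReal_add ha hb]
        gcongr
        exact (ENNReal.ofReal_le_ofReal hab).trans (by simp)

/-- The constant in the elementary half-plane interpolation inequality. -/
noncomputable def interpConst (p : ℝ) : ℝ≥0∞ :=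
  ENNReal.ofReal (p - 1) * (1 + 11 * 11 * 11 ^ (p - 2))

lemma interpConst_ne_top {p : ℝ} (hp : 2 ≤ p) : interpConst p ≠ ∞ := by
  have : (11 : ℝ≥0∞) ^ (p - 2) ≠ ∞ := ENNReal.rpow_ne_top_of_nonneg (by linarith) (by simp)
  unfold interpConst
  finiteness

section
variable {v w z : ℝ × ℝ → ℝ} {p : ℝ} {r s : ℝ≥0∞}

lemma eLpNorm_halfPlane_ne_top (hw : Continuous w) (hs : HasCompactSupport w) (r : ℝ≥0∞) :
    eLpNorm w r halfPlaneMeasure ≠ ∞ := by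
  have : MemLp w r (volume.prod volume) := hw.memLp_of_hasCompactSupport hs
  exact ((this.mono_measure (Measure.prod_mono Measure.restrict_le_self le_rfl)).2).ne

lemma HasCompactSupport.slice_left (hs : HasCompactSupport v) (y : ℝ) :
    HasCompactSupport fun x => v (x, y) :=
  .intro (hs.isCompact.image continuous_fst) fun _ hx =>
    image_eq_zero_of_notMem_tsupport fun h => hx ⟨_, h, rfl⟩

lemma HasCompactSupport.slice_right (hs : HasCompactSupport v) (x : ℝ) :
    HasCompactSupport fun y => v (x, y) :=
  .intro (hs.isCompact.image continuous_snd) fun _ hy =>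
    image_eq_zero_of_notMem_tsupport fun h => hy ⟨_, h, rfl⟩

lemma measurable_enorm_mul_rpow_mul (hv : Continuous v) (hw : Continuous w) (hz : Continuous z) :
    Measurable fun q => ‖v q‖ₑ * ‖w q‖ₑ ^ (p - 2) * ‖z q‖ₑ :=
  (hv.measurable.enorm.mul (hw.measurable.enorm.pow_const _)).mul hz.measurable.enorm

lemma eLpNorm_partial_fst_sq_le (hp : 2 ≤ p) (hr : 1 ≤ r) (hs : 1 ≤ s)
    (hrs : r⁻¹ + s⁻¹ = (ENNReal.ofReal (p / 2))⁻¹)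
    (hv : Continuous v) (hw : Continuous w) (hz : Continuous z)
    (cv : HasCompactSupport v) (cw : HasCompactSupport w)
    (h₁ : ∀ q, HasDerivAt (fun x => v (x, q.2)) (w q) q.1)
    (h₂ : ∀ q, HasDerivAt (fun x => w (x, q.2)) (z q) q.1) :
    eLpNorm w (ENNReal.ofReal p) halfPlaneMeasure ^ 2 ≤
      interpConst p * (eLpNorm v r halfPlaneMeasure * eLpNorm z s halfPlaneMeasure) := by
  have hg : Continuous fun q : ℝ × ℝ => 3 * v q - 2 * v (2 * q.1, q.2) := by fun_prop
  have hg₁ : Continuous fun q : ℝ × ℝ => 3 * w q - 4 * w (2 * q.1, q.2) := by fun_prop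
  have hg₂ : Continuous fun q : ℝ × ℝ => 3 * z q - 8 * z (2 * q.1, q.2) := by fun_prop
  refine eLpNorm_sq_le_of_lintegral_le hp hrs hv.aestronglyMeasurable hw.aestronglyMeasurable
    hz.aestronglyMeasurable hg.aestronglyMeasurable hg₁.aestronglyMeasurable
    hg₂.aestronglyMeasurable (eLpNorm_halfPlane_ne_top hw cw _)
    (eLpNorm_sub_dilation_le hv hr (by norm_num) (by norm_num) (by norm_num))
    (eLpNorm_sub_dilation_le hw (ENNReal.one_le_ofReal.mpr (by linarith)) (by norm_num)
      (by norm_num) (by norm_num))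
    (eLpNorm_sub_dilation_le hz hs (by norm_num) (by norm_num) (by norm_num)) ?_
  have m₁ := measurable_enorm_mul_rpow_mul (p := p) hv hw hz
  have m₂ := measurable_enorm_mul_rpow_mul (p := p) hg hg₁ hg₂
  rw [halfPlaneMeasure, lintegral_prod_symm' _ (hw.measurable.enorm.pow_const p),
    lintegral_prod_symm' _ m₁, lintegral_prod_symm' _ m₂,
    ← lintegral_add_left m₁.lintegral_prod_left',
    ← lintegral_const_mul' _ _ ENNReal.ofReal_ne_top]
  refine lintegral_mono fun y => ?_
  exact lintegral_Ioi_enorm_deriv_rpow_le hp (fun x => h₁ (x, y)) (fun x => h₂ (x, y))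
    (by fun_prop) (cv.slice_left y)

lemma eLpNorm_partial_snd_sq_le (hp : 2 ≤ p)
    (hrs : r⁻¹ + s⁻¹ = (ENNReal.ofReal (p / 2))⁻¹)
    (hv : Continuous v) (hw : Continuous w) (hz : Continuous z)
    (cv : HasCompactSupport v) (cw : HasCompactSupport w)
    (h₁ : ∀ q, HasDerivAt (fun y => v (q.1, y)) (w q) q.2)
    (h₂ : ∀ q, HasDerivAt (fun y => w (q.1, y)) (z q) q.2) :
    eLpNorm w (ENNReal.ofReal p) halfPlaneMeasure ^ 2 ≤
      interpConst p * (eLpNorm v r halfPlaneMeasure * eLpNorm z s halfPlaneMeasure) := by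
  have h11 : ∀ a : ℝ≥0∞, a ≤ 11 * a := fun a => le_mul_of_one_le_left' (by norm_num)
  refine eLpNorm_sq_le_of_lintegral_le hp hrs hv.aestronglyMeasurable hw.aestronglyMeasurable
    hz.aestronglyMeasurable hv.aestronglyMeasurable hw.aestronglyMeasurable
    hz.aestronglyMeasurable (eLpNorm_halfPlane_ne_top hw cw _) (h11 _) (h11 _) (h11 _) ?_
  have m₁ := measurable_enorm_mul_rpow_mul (p := p) hv hw hz
  refine le_trans ?_ (mul_le_mul_right le_self_add _)
  rw [halfPlaneMeasure, lintegral_prod _ (hw.measurable.enorm.pow_const p).aemeasurable,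
    lintegral_prod _ m₁.aemeasurable, ← lintegral_const_mul' _ _ ENNReal.ofReal_ne_top]
  refine lintegral_mono fun x => ?_
  exact lintegral_enorm_deriv_rpow_le hp (fun y => h₁ (x, y)) (fun y => h₂ (x, y))
    (by fun_prop) (cv.slice_right x)

end

section
variable {v : ℝ × ℝ → ℝ}

lemma deriv_slice_fst (hv : Differentiable ℝ v) (q : ℝ × ℝ) :
    HasDerivAt (fun x => v (x, q.2)) (fderiv ℝ v q (1, 0)) q.1 :=
  (hv q).hasFDerivAt.comp_hasDerivAt q.1 ((hasDerivAt_id q.1).prodMk (hasDerivAt_const q.1 q.2))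

lemma deriv_slice_snd (hv : Differentiable ℝ v) (q : ℝ × ℝ) :
    HasDerivAt (fun y => v (q.1, y)) (fderiv ℝ v q (0, 1)) q.2 :=
  (hv q).hasFDerivAt.comp_hasDerivAt q.2 ((hasDerivAt_const q.2 q.1).prodMk (hasDerivAt_id q.2))

lemma pd_zero_zero (u : ℝ × ℝ → ℝ) : pd 0 0 u = u := by
  ext q; simp [pd]

lemma pd_succ_left (s t : ℕ) (u : ℝ × ℝ → ℝ) (q : ℝ × ℝ) :
    pd (s + 1) t u q = deriv (fun x => pd s t u (x, q.2)) q.1 := by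
  simp only [pd, iteratedDeriv_succ]

lemma pd_zero_succ (t : ℕ) (u : ℝ × ℝ → ℝ) (q : ℝ × ℝ) :
    pd 0 (t + 1) u q = deriv (fun y => pd 0 t u (q.1, y)) q.2 := by
  simp only [pd, iteratedDeriv_succ, iteratedDeriv_zero]

lemma pd_succ_left_eq_fderiv {s t : ℕ} {u : ℝ × ℝ → ℝ} (h : Differentiable ℝ (pd s t u)) :
    pd (s + 1) t u = fun q => fderiv ℝ (pd s t u) q (1, 0) :=
  funext fun q => by rw [pd_succ_left, (deriv_slice_fst h q).deriv]

lemma pd_zero_succ_eq_fderiv {t : ℕ} {u : ℝ × ℝ → ℝ} (h : Differentiable ℝ (pd 0 t u)) :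
    pd 0 (t + 1) u = fun q => fderiv ℝ (pd 0 t u) q (0, 1) :=
  funext fun q => by rw [pd_zero_succ, (deriv_slice_snd h q).deriv]

variable {m : ℕ} {u : ℝ × ℝ → ℝ}

lemma contDiff_pd_zero (hu : ContDiff ℝ m u) (t : ℕ) :
    ∀ n : ℕ, n + t ≤ m → ContDiff ℝ n (pd 0 t u) := by
  induction t with
  | zero => intro n hn; rw [pd_zero_zero]; exact hu.of_le (by exact_mod_cast hn)
  | succ t ih =>
    intro n hn
    have h := ih (n + 1) (by omega)
    rw [pd_zero_succ_eq_fderiv (h.differentiable (by simp))]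
    exact (h.fderiv_right (m := n) (by norm_cast)).clm_apply contDiff_const

lemma contDiff_pd (hu : ContDiff ℝ m u) (s t : ℕ) :
    ∀ n : ℕ, n + (s + t) ≤ m → ContDiff ℝ n (pd s t u) := by
  induction s with
  | zero => simpa using contDiff_pd_zero hu t
  | succ s ih =>
    intro n hn
    have h := ih (n + 1) (by omega)
    rw [pd_succ_left_eq_fderiv (h.differentiable (by simp))]
    exact (h.fderiv_right (m := n) (by norm_cast)).clm_apply contDiff_const

lemma continuous_pd (hu : ContDiff ℝ m u) {s t : ℕ} (h : s + t ≤ m) : Continuous (pd s t u) :=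
  (contDiff_pd hu s t 0 (by omega)).continuous

lemma differentiable_pd (hu : ContDiff ℝ m u) {s t : ℕ} (h : s + t < m) :
    Differentiable ℝ (pd s t u) :=
  (contDiff_pd hu s t 1 (by omega)).differentiable (by simp)

lemma hasCompactSupport_pd (hu : ContDiff ℝ m u) (hc : HasCompactSupport u) {s t : ℕ}
    (h : s + t ≤ m) : HasCompactSupport (pd s t u) := by
  induction s with
  | zero =>
    induction t with
    | zero => rwa [pd_zero_zero]
    | succ t ih =>
      rw [pd_zero_succ_eq_fderiv (differentiable_pd hu (by omega))]
      exact (ih (by omega)).fderiv_apply (𝕜 := ℝ) _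
  | succ s ih =>
    rw [pd_succ_left_eq_fderiv (differentiable_pd hu (by omega))]
    exact (ih (by omega)).fderiv_apply (𝕜 := ℝ) _

lemma hasDerivAt_pd_fst (hu : ContDiff ℝ m u) {s t : ℕ} (h : s + t < m) (q : ℝ × ℝ) :
    HasDerivAt (fun x => pd s t u (x, q.2)) (pd (s + 1) t u q) q.1 := by
  have hd := differentiable_pd hu h
  rw [pd_succ_left_eq_fderiv hd]
  exact deriv_slice_fst hd q

lemma hasDerivAt_pd_snd (hu : ContDiff ℝ m u) {t : ℕ} (h : t < m) (q : ℝ × ℝ) :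
    HasDerivAt (fun y => pd 0 t u (q.1, y)) (pd 0 (t + 1) u q) q.2 := by
  have hd := differentiable_pd (s := 0) (t := t) hu (by omega)
  rw [pd_zero_succ_eq_fderiv hd]
  exact deriv_slice_snd hd q

end

/-- The exponent `2 m / k` (equal to `∞` for `k = 0`). -/
noncomputable def gnExp (m k : ℕ) : ℝ≥0∞ := (ENNReal.ofReal (k / (2 * m)))⁻¹

lemma gnExp_zero (m : ℕ) : gnExp m 0 = ∞ := by simp [gnExp]

lemma gnExp_self {m : ℕ} (hm : m ≠ 0) : gnExp m m = 2 := by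
  rw [gnExp, show (m : ℝ) / (2 * m) = 2⁻¹ by field_simp, ENNReal.ofReal_inv_of_pos two_pos]
  simp

lemma gnExp_succ {m : ℕ} (hm : m ≠ 0) (k : ℕ) :
    gnExp m (k + 1) = ENNReal.ofReal (2 * m / (k + 1)) := by
  rw [gnExp, ← ENNReal.ofReal_inv_of_pos (by positivity)]
  congr 1
  push_cast
  field_simp

lemma one_le_gnExp {m k : ℕ} (hk : k ≤ m) : 1 ≤ gnExp m k := by
  rw [gnExp, ENNReal.one_le_inv, ENNReal.ofReal_le_one]
  refine div_le_one_of_le₀ ?_ (by positivity)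
  have : (k : ℝ) ≤ m := by exact_mod_cast hk
  linarith

lemma gnExp_inv_add_inv {m : ℕ} (hm : m ≠ 0) (k : ℕ) :
    (gnExp m k)⁻¹ + (gnExp m (k + 2))⁻¹ = (ENNReal.ofReal (2 * m / (k + 1) / 2))⁻¹ := by
  rw [gnExp, gnExp, inv_inv, inv_inv, ← ENNReal.ofReal_add (by positivity) (by positivity),
    ← ENNReal.ofReal_inv_of_pos (by positivity)]
  congr 1
  push_cast
  field_simp
  ring

section
variable {m : ℕ} {u : ℝ × ℝ → ℝ}

/-- The sum of the `L ^ (2 m / k)` norms of the `k`-th order partial derivatives. -/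
noncomputable def gnNorm (m k : ℕ) (u : ℝ × ℝ → ℝ) : ℝ :=
  ∑ a ∈ Finset.HasAntidiagonal.antidiagonal k,
    (eLpNorm (pd a.1 a.2 u) (gnExp m k) halfPlaneMeasure).toReal

lemma gnNorm_nonneg (m k : ℕ) (u : ℝ × ℝ → ℝ) : 0 ≤ gnNorm m k u :=
  Finset.sum_nonneg fun _ _ => ENNReal.toReal_nonneg

lemma toReal_eLpNorm_pd_le_gnNorm (m s t : ℕ) (u : ℝ × ℝ → ℝ) :
    (eLpNorm (pd s t u) (gnExp m (s + t)) halfPlaneMeasure).toReal ≤ gnNorm m (s + t) u :=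
  Finset.single_le_sum (s := Finset.HasAntidiagonal.antidiagonal (s + t)) (a := (s, t))
    (f := fun a : ℕ × ℕ => (eLpNorm (pd a.1 a.2 u) (gnExp m (s + t)) halfPlaneMeasure).toReal)
    (fun _ _ => ENNReal.toReal_nonneg) (Finset.HasAntidiagonal.mem_antidiagonal.mpr rfl)

lemma toReal_eLpNorm_pd_sq_le (hu : ContDiff ℝ m u) (hc : HasCompactSupport u) {s t k : ℕ}
    (hst : s + t = k + 1) (hk : k + 2 ≤ m) :
    (eLpNorm (pd s t u) (gnExp m (k + 1)) halfPlaneMeasure).toReal ^ 2 ≤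
      (interpConst (2 * m / (k + 1))).toReal * (gnNorm m k u * gnNorm m (k + 2) u) := by
  have hm : m ≠ 0 := by omega
  have hkm : (k : ℝ) + 2 ≤ m := by exact_mod_cast hk
  have hp : (2 : ℝ) ≤ 2 * m / (k + 1) := by
    rw [le_div_iff₀ (by positivity)]
    linarith
  suffices h : ∃ s₀ t₀ s₂ t₂ : ℕ, s₀ + t₀ = k ∧ s₂ + t₂ = k + 2 ∧
      eLpNorm (pd s t u) (gnExp m (k + 1)) halfPlaneMeasure ^ 2 ≤
        interpConst (2 * m / (k + 1)) *
          (eLpNorm (pd s₀ t₀ u) (gnExp m k) halfPlaneMeasure *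
            eLpNorm (pd s₂ t₂ u) (gnExp m (k + 2)) halfPlaneMeasure) by
    obtain ⟨s₀, t₀, s₂, t₂, h₀, h₂, h⟩ := h
    have f₀ := eLpNorm_halfPlane_ne_top (continuous_pd hu (s := s₀) (t := t₀) (by omega))
      (hasCompactSupport_pd hu hc (by omega)) (gnExp m k)
    have f₂ := eLpNorm_halfPlane_ne_top (continuous_pd hu (s := s₂) (t := t₂) (by omega))
      (hasCompactSupport_pd hu hc (by omega)) (gnExp m (k + 2))
    have h' := ENNReal.toReal_mono
      (ENNReal.mul_ne_top (interpConst_ne_top hp) (ENNReal.mul_ne_top f₀ f₂)) h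
    rw [ENNReal.toReal_pow, ENNReal.toReal_mul, ENNReal.toReal_mul] at h'
    refine h'.trans ?_
    have b₀ := toReal_eLpNorm_pd_le_gnNorm m s₀ t₀ u
    have b₂ := toReal_eLpNorm_pd_le_gnNorm m s₂ t₂ u
    rw [h₀] at b₀
    rw [h₂] at b₂
    gcongr
    exact gnNorm_nonneg _ _ _
  rw [gnExp_succ hm k]
  rcases s with _ | s
  · obtain rfl : t = k + 1 := by omega
    refine ⟨0, k, 0, k + 2, by omega, by omega, ?_⟩
    exact eLpNorm_partial_snd_sq_le hp (gnExp_inv_add_inv hm k)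
      (continuous_pd hu (by omega)) (continuous_pd hu (by omega)) (continuous_pd hu (by omega))
      (hasCompactSupport_pd hu hc (by omega)) (hasCompactSupport_pd hu hc (by omega))
      (hasDerivAt_pd_snd hu (by omega)) (hasDerivAt_pd_snd hu (by omega))
  · refine ⟨s, t, s + 2, t, by omega, by omega, ?_⟩
    exact eLpNorm_partial_fst_sq_le hp (one_le_gnExp (by omega)) (one_le_gnExp (by omega))
      (gnExp_inv_add_inv hm k)
      (continuous_pd hu (by omega)) (continuous_pd hu (by omega)) (continuous_pd hu (by omega))
      (hasCompactSupport_pd hu hc (by omega)) (hasCompactSupport_pd hu hc (by omega))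
      (hasDerivAt_pd_fst hu (by omega)) (hasDerivAt_pd_fst hu (by omega))

lemma gnNorm_sq_le (hu : ContDiff ℝ m u) (hc : HasCompactSupport u) {k : ℕ} (hk : k + 2 ≤ m) :
    gnNorm m (k + 1) u ^ 2 ≤ ((k + 2) ^ 2 * (interpConst (2 * m / (k + 1))).toReal) *
      (gnNorm m k u * gnNorm m (k + 2) u) := by
  have h := sq_sum_le_card_mul_sum_sq (s := Finset.HasAntidiagonal.antidiagonal (k + 1))
    (f := fun a => (eLpNorm (pd a.1 a.2 u) (gnExp m (k + 1)) halfPlaneMeasure).toReal)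
  refine h.trans ?_
  have h2 := Finset.sum_le_card_nsmul (Finset.HasAntidiagonal.antidiagonal (k + 1)) _ _ fun a ha =>
    toReal_eLpNorm_pd_sq_le hu hc (Finset.HasAntidiagonal.mem_antidiagonal.mp ha) hk
  refine (mul_le_mul_of_nonneg_left h2 (by positivity)).trans (le_of_eq ?_)
  rw [Finset.Nat.card_antidiagonal, nsmul_eq_mul]
  push_cast
  ring

end

lemma pow_le_of_sq_le {m : ℕ} {b : ℕ → ℝ} (hb : ∀ k, 0 ≤ b k)
    (h : ∀ k, k + 2 ≤ m → b (k + 1) ^ 2 ≤ b k * b (k + 2)) {k : ℕ} (hk : k ≤ m) :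
    b k ^ m ≤ b 0 ^ (m - k) * b m ^ k := by
  have h1 : ∀ k, k + 1 ≤ m → b k ^ (k + 1) ≤ b 0 * b (k + 1) ^ k := by
    intro k
    induction k with
    | zero => simp
    | succ k ih =>
      intro hk
      rcases (hb (k + 1)).eq_or_lt with h0 | h0
      · rw [← h0, zero_pow (by omega)]
        exact mul_nonneg (hb 0) (pow_nonneg (hb _) _)
      · have e := ih (by omega)
        have e2 := pow_le_pow_left₀ (by positivity) (h k (by omega)) (k + 1)
        refine le_of_mul_le_mul_left ?_ (pow_pos h0 k)
        calc b (k + 1) ^ k * b (k + 1) ^ (k + 1 + 1) = (b (k + 1) ^ 2) ^ (k + 1) := by ring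
          _ ≤ (b k * b (k + 2)) ^ (k + 1) := e2
          _ = b k ^ (k + 1) * b (k + 2) ^ (k + 1) := mul_pow _ _ _
          _ ≤ (b 0 * b (k + 1) ^ k) * b (k + 2) ^ (k + 1) := by
            gcongr
            exact pow_nonneg (hb _) _
          _ = _ := by ring
  induction hk using Nat.decreasingInduction with
  | self => simp
  | of_succ k hk ih =>
    refine le_of_pow_le_pow_left₀ (n := k + 1) (by omega)
      (mul_nonneg (pow_nonneg (hb _) _) (pow_nonneg (hb _) _)) ?_
    obtain ⟨j, rfl⟩ : ∃ j, m = k + 1 + j := ⟨m - (k + 1), by omega⟩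
    rw [show k + 1 + j - (k + 1) = j by omega] at ih
    rw [show k + 1 + j - k = j + 1 by omega]
    calc (b k ^ (k + 1 + j)) ^ (k + 1) = (b k ^ (k + 1)) ^ (k + 1 + j) := by ring
      _ ≤ (b 0 * b (k + 1) ^ k) ^ (k + 1 + j) :=
        pow_le_pow_left₀ (pow_nonneg (hb _) _) (h1 k (by omega)) _
      _ = b 0 ^ (k + 1 + j) * (b (k + 1) ^ (k + 1 + j)) ^ k := by ring
      _ ≤ b 0 ^ (k + 1 + j) * (b 0 ^ j * b (k + 1 + j) ^ (k + 1)) ^ k := by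
        gcongr
        · exact pow_nonneg (hb _) _
        · exact pow_nonneg (hb _) _
      _ = _ := by ring

lemma pow_le_of_sq_le_const_mul {m : ℕ} {a : ℕ → ℝ} {E : ℝ} (hE : 1 ≤ E) (ha : ∀ k, 0 ≤ a k)
    (h : ∀ k, k + 2 ≤ m → a (k + 1) ^ 2 ≤ E ^ 2 * (a k * a (k + 2))) {k : ℕ} (hk : k ≤ m) :
    a k ^ m ≤ E ^ m ^ 3 * (a 0 ^ (m - k) * a m ^ k) := by
  have hE0 : 0 < E := by linarith
  have hb := pow_le_of_sq_le (m := m) (b := fun k => E ^ k ^ 2 * a k)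
    (fun k => mul_nonneg (by positivity) (ha k)) (fun k hk => by
      calc (E ^ (k + 1) ^ 2 * a (k + 1)) ^ 2 = (E ^ (k + 1) ^ 2) ^ 2 * a (k + 1) ^ 2 := by ring
        _ ≤ (E ^ (k + 1) ^ 2) ^ 2 * (E ^ 2 * (a k * a (k + 2))) := by gcongr; exact h k hk
        _ = _ := by ring) hk
  have hn : ∀ n j, 0 ≤ a n ^ j := fun n j => pow_nonneg (ha n) j
  calc a k ^ m ≤ (E ^ k ^ 2 * a k) ^ m := by
        refine pow_le_pow_left₀ (ha k) (le_mul_of_one_le_left (ha k) (one_le_pow₀ hE)) _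
    _ ≤ (E ^ 0 ^ 2 * a 0) ^ (m - k) * (E ^ m ^ 2 * a m) ^ k := hb
    _ = E ^ (m ^ 2 * k) * (a 0 ^ (m - k) * a m ^ k) := by
      rw [zero_pow two_ne_zero, pow_zero, one_mul, mul_pow, ← pow_mul]; ring
    _ ≤ _ := by
      refine mul_le_mul_of_nonneg_right (pow_le_pow_right₀ hE ?_) (mul_nonneg (hn _ _) (hn _ _))
      calc m ^ 2 * k ≤ m ^ 2 * m := by gcongr
        _ = m ^ 3 := by ring

/-- Gagliardo–Nirenberg inequality for compactly supported functions. -/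
lemma exists_gnNorm_pow_le (m : ℕ) : ∃ K : ℝ, 0 ≤ K ∧ ∀ u : ℝ × ℝ → ℝ, ContDiff ℝ m u →
    HasCompactSupport u → ∀ k ≤ m,
      gnNorm m k u ^ m ≤ K * (gnNorm m 0 u ^ (m - k) * gnNorm m m u ^ k) := by
  set A : ℕ → ℝ := fun k => (k + 2) ^ 2 * (interpConst (2 * m / (k + 1))).toReal with hA
  have hA0 : ∀ k, 0 ≤ A k := fun k => by positivity
  set E : ℝ := 1 + ∑ k ∈ Finset.range m, A k with hE
  have hE1 : 1 ≤ E := le_add_of_nonneg_right (Finset.sum_nonneg fun k _ => hA0 k)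
  refine ⟨E ^ m ^ 3, by positivity, fun u hu hc k hk => ?_⟩
  refine pow_le_of_sq_le_const_mul hE1 (fun k => gnNorm_nonneg m k u) (fun k hk => ?_) hk
  refine (gnNorm_sq_le hu hc hk).trans ?_
  refine mul_le_mul_of_nonneg_right ?_ (mul_nonneg (gnNorm_nonneg _ _ _) (gnNorm_nonneg _ _ _))
  have h1 : A k ≤ E := (Finset.single_le_sum (fun k _ => hA0 k)
    (Finset.mem_range.mpr (by omega : k < m))).trans (le_add_of_nonneg_left zero_le_one)
  exact h1.trans (le_self_pow₀ hE1 two_ne_zero)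

lemma exists_cutoff (m : ℕ) : ∃ D : ℝ, 0 ≤ D ∧ ∃ φ : ℕ → ℝ → ℝ,
    (∀ n, ContDiff ℝ m (φ n)) ∧ (∀ n, HasCompactSupport (φ n)) ∧ (∀ n x, |φ n x| ≤ 1) ∧
    (∀ x, ∀ᶠ n in Filter.atTop, φ n =ᶠ[nhds x] 1) ∧
    ∀ n, ∀ j ≤ m, ∀ x, |iteratedDeriv j (φ n) x| ≤ D := by
  let φ : ContDiffBump (0 : ℝ) := ⟨1, 2, by norm_num, by norm_num⟩
  have hφ : ∀ j : ℕ, ContDiff ℝ j φ := fun j => φ.contDiff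
  have hb : ∀ j : ℕ, ∃ D, ∀ x, ‖iteratedDeriv j φ x‖ ≤ D := fun j => by
    refine ((hφ j).continuous_iteratedDeriv j le_rfl).bounded_above_of_compact_support ?_
    induction j with
    | zero => simpa using φ.hasCompactSupport
    | succ j ih => rw [iteratedDeriv_succ]; exact ih.deriv
  choose D hD using hb
  have hD0 : ∀ j, 0 ≤ D j := fun j => (norm_nonneg _).trans (hD j 0)
  refine ⟨∑ j ∈ Finset.range (m + 1), D j, Finset.sum_nonneg fun j _ => hD0 j,
    fun n x => φ (((n : ℝ) + 1)⁻¹ * x), fun n => ?_, fun n => ?_, fun n x => ?_, fun x => ?_,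
    fun n j hj x => ?_⟩
  · exact (hφ m).comp (contDiff_const.mul contDiff_id)
  · exact φ.hasCompactSupport.comp_homeomorph
      (Homeomorph.mulLeft₀ ((n : ℝ) + 1)⁻¹ (by positivity))
  · rw [abs_of_nonneg φ.nonneg]
    exact φ.le_one
  · obtain ⟨N, hN⟩ := exists_nat_gt |x|
    filter_upwards [Filter.eventually_ge_atTop N] with n hn
    have hx : |x| < (n : ℝ) + 1 := by
      have : (N : ℝ) ≤ n := by exact_mod_cast hn
      linarith
    filter_upwards [continuous_abs.continuousAt.eventually_lt_const hx] with y hy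
    refine φ.one_of_mem_closedBall ?_
    rw [mem_closedBall_zero_iff, Real.norm_eq_abs, abs_mul, abs_inv,
      abs_of_pos (by positivity : (0 : ℝ) < (n : ℝ) + 1), inv_mul_le_iff₀ (by positivity)]
    simpa [φ] using hy.le
  · rw [iteratedDeriv_comp_const_mul (hφ j), abs_mul]
    refine le_trans ?_ (Finset.single_le_sum (fun j _ => hD0 j)
      (Finset.mem_range.mpr (by omega : j < m + 1)))
    refine (mul_le_of_le_one_left (abs_nonneg _) ?_).trans (hD j _)
    rw [abs_of_nonneg (by positivity)]
    exact pow_le_one₀ (by positivity) (inv_le_one_of_one_le₀ (by simp))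

section
variable {m : ℕ} {u : ℝ × ℝ → ℝ} {a b : ℝ → ℝ}

lemma contDiff_slice_pd_zero (hu : ContDiff ℝ m u) {s t : ℕ} (h : s + t ≤ m) (y : ℝ) :
    ContDiff ℝ s fun x => pd 0 t u (x, y) :=
  (contDiff_pd_zero hu t s h).comp (contDiff_id.prodMk contDiff_const)

/-- Leibniz formula for the product with a tensor product of functions of one variable. -/
lemma pd_mul (ha : ContDiff ℝ m a) (hb : ContDiff ℝ m b) (hu : ContDiff ℝ m u) {s t : ℕ}
    (h : s + t ≤ m) (q : ℝ × ℝ) :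
    pd s t (fun q => a q.1 * (b q.2 * u q)) q =
      ∑ i ∈ Finset.range (s + 1), (s.choose i * iteratedDeriv i a q.1) *
        ∑ j ∈ Finset.range (t + 1), (t.choose j * iteratedDeriv j b q.2) *
          pd (s - i) (t - j) u q := by
  have hin : ∀ x, iteratedDeriv t (fun y => a x * (b y * u (x, y))) q.2 =
      a x * ∑ j ∈ Finset.range (t + 1), (t.choose j * iteratedDeriv j b q.2) *
        pd 0 (t - j) u (x, q.2) := fun x => by
    rw [iteratedDeriv_const_mul_field, iteratedDeriv_fun_mul]
    · simp only [pd, iteratedDeriv_zero]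
    · exact (hb.of_le (by exact_mod_cast (by omega : t ≤ m))).contDiffAt
    · exact ((hu.of_le (by exact_mod_cast (by omega : t ≤ m))).comp
        (contDiff_const.prodMk contDiff_id)).contDiffAt
  have hF : ∀ n : ℕ, n ≤ s → ∀ j, ContDiff ℝ n fun x => (t.choose j * iteratedDeriv j b q.2) *
      pd 0 (t - j) u (x, q.2) := fun n hn j =>
    contDiff_const.mul (contDiff_slice_pd_zero hu (by omega) _)
  calc _ = iteratedDeriv s (fun x => a x * ∑ j ∈ Finset.range (t + 1),
        (t.choose j * iteratedDeriv j b q.2) * pd 0 (t - j) u (x, q.2)) q.1 := by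
        simp only [pd] at hin ⊢
        simp_rw [hin]
    _ = _ := by
      rw [iteratedDeriv_fun_mul (ha.of_le (by exact_mod_cast (by omega : s ≤ m))).contDiffAt
        (ContDiff.sum fun j _ => hF s le_rfl j).contDiffAt]
      refine Finset.sum_congr rfl fun i _ => ?_
      rw [iteratedDeriv_fun_sum fun j _ => (hF (s - i) (by omega) j).contDiffAt]
      congr 1
      refine Finset.sum_congr rfl fun j _ => ?_
      rw [iteratedDeriv_const_mul_field]
      simp only [pd, iteratedDeriv_zero]

lemma abs_pd_mul_le (ha : ContDiff ℝ m a) (hb : ContDiff ℝ m b) (hu : ContDiff ℝ m u) {D : ℝ}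
    (hD : 0 ≤ D) (hDa : ∀ j ≤ m, ∀ x, |iteratedDeriv j a x| ≤ D)
    (hDb : ∀ j ≤ m, ∀ x, |iteratedDeriv j b x| ≤ D) {s t : ℕ} (h : s + t ≤ m) (q : ℝ × ℝ) :
    |pd s t (fun q => a q.1 * (b q.2 * u q)) q| ≤ (2 ^ m * D) ^ 2 *
      ∑ c ∈ Finset.range (s + 1) ×ˢ Finset.range (t + 1), |pd (s - c.1) (t - c.2) u q| := by
  have hch : ∀ n k : ℕ, n ≤ m → (n.choose k : ℝ) ≤ 2 ^ m := fun n k hn => by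
    exact_mod_cast (Nat.choose_le_two_pow n k).trans (Nat.pow_le_pow_right two_pos hn)
  rw [pd_mul ha hb hu h, Finset.sum_product, Finset.mul_sum]
  refine (Finset.abs_sum_le_sum_abs _ _).trans (Finset.sum_le_sum fun i hi => ?_)
  have hi := Finset.mem_range.mp hi
  have key : |∑ j ∈ Finset.range (t + 1), (t.choose j * iteratedDeriv j b q.2) *
      pd (s - i) (t - j) u q| ≤
      (2 ^ m * D) * ∑ j ∈ Finset.range (t + 1), |pd (s - i) (t - j) u q| := by
    rw [Finset.mul_sum]
    refine (Finset.abs_sum_le_sum_abs _ _).trans (Finset.sum_le_sum fun j hj => ?_)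
    have hj := Finset.mem_range.mp hj
    rw [abs_mul, abs_mul, Nat.abs_cast]
    gcongr
    · exact hch _ _ (by omega)
    · exact hDb j (by omega) _
  rw [abs_mul, abs_mul, Nat.abs_cast, sq, mul_assoc (2 ^ m * D)]
  exact mul_le_mul (mul_le_mul (hch _ _ (by omega)) (hDa i (by omega) _) (abs_nonneg _)
    (by positivity)) key (abs_nonneg _) (by positivity)

lemma pd_congr_of_eventuallyEq_one {q : ℝ × ℝ} (ha : a =ᶠ[nhds q.1] 1)
    (hb : b =ᶠ[nhds q.2] 1) (s t : ℕ) :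
    pd s t (fun q => a q.1 * (b q.2 * u q)) q = pd s t u q := by
  refine Filter.EventuallyEq.iteratedDeriv_eq s ?_
  filter_upwards [ha] with x hx
  refine Filter.EventuallyEq.iteratedDeriv_eq t ?_
  filter_upwards [hb] with y hy
  simp [hx, hy]

end

section
variable {X : Type*} [MeasurableSpace X] {μ : Measure X}

lemma sqrt_integral_sq {f : X → ℝ} (hf : AEStronglyMeasurable f μ) :
    Real.sqrt (∫ x, f x ^ 2 ∂μ) = (eLpNorm f 2 μ).toReal := by
  have h := eLpNorm_ofReal_rpow (μ := μ) two_pos f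
  simp only [ENNReal.ofReal_ofNat, ENNReal.rpow_ofNat] at h
  rw [integral_eq_lintegral_of_nonneg_ae (.of_forall fun x => sq_nonneg _) (hf.pow 2),
    show ∫⁻ x, ENNReal.ofReal (f x ^ 2) ∂μ = eLpNorm f 2 μ ^ 2 by
      rw [h]
      refine lintegral_congr fun x => ?_
      rw [Real.enorm_eq_ofReal_abs, ← ENNReal.ofReal_pow (abs_nonneg _), sq_abs],
    ENNReal.toReal_pow, Real.sqrt_sq ENNReal.toReal_nonneg]

lemma eLpNorm_prod_le {ι : Type*} (S : Finset ι) {f : ι → X → ℝ}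
    (hf : ∀ i ∈ S, AEStronglyMeasurable (f i) μ) (p : ι → ℝ≥0∞) :
    eLpNorm (∏ i ∈ S, f i) (∑ i ∈ S, (p i)⁻¹)⁻¹ μ ≤ ∏ i ∈ S, eLpNorm (f i) (p i) μ := by
  induction S using Finset.cons_induction with
  | empty =>
    rw [Finset.prod_empty, Finset.sum_empty, Finset.prod_empty, ENNReal.inv_zero,
      eLpNorm_exponent_top]
    refine (eLpNormEssSup_le_of_ae_bound (C := 1) (.of_forall fun x => by simp)).trans (by simp)
  | cons i s hi ih =>
    have ih := ih fun j hj => hf j (Finset.mem_cons_of_mem hj)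
    rw [Finset.prod_cons, Finset.prod_cons]
    refine (eLpNorm_smul_le_mul_eLpNorm (φ := f i) (f := ∏ i ∈ s, f i) (p := p i)
      (q := (∑ i ∈ s, (p i)⁻¹)⁻¹) (hpqr := ⟨by simp⟩) ?_ (hf i (Finset.mem_cons_self _ _))).trans ?_
    · exact Finset.aestronglyMeasurable_prod _ fun j hj => hf j (Finset.mem_cons_of_mem hj)
    · gcongr

end

lemma volume_restrict_halfPlane : volume.restrict halfPlane = halfPlaneMeasure := by
  have : halfPlane = Ici 0 ×ˢ univ := by ext; simp [halfPlane]
  rw [this, halfPlaneMeasure, Measure.volume_eq_prod, ← Measure.prod_restrict,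
    Measure.restrict_univ, restrict_Ioi_eq_restrict_Ici]

lemma measurableSet_halfPlane : MeasurableSet halfPlane :=
  measurableSet_le measurable_const measurable_fst

section
variable {m : ℕ} {u : ℝ × ℝ → ℝ}

lemma integral_pd_sq_le_sobNormSq (u : ℝ × ℝ → ℝ) {s t : ℕ} (h : s + t ≤ m) :
    ∫ q in halfPlane, pd s t u q ^ 2 ≤ sobNormSq m halfPlane u := by
  have h0 : ∀ s t : ℕ, 0 ≤ if s + t ≤ m then ∫ q in halfPlane, pd s t u q ^ 2 else 0 := by
    intro s t
    split_ifs
    · exact integral_nonneg fun _ => sq_nonneg _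
    · exact le_rfl
  calc _ = if s + t ≤ m then ∫ q in halfPlane, pd s t u q ^ 2 else 0 := by rw [if_pos h]
    _ ≤ ∑ t ∈ Finset.range (m + 1),
        if s + t ≤ m then ∫ q in halfPlane, pd s t u q ^ 2 else 0 :=
      Finset.single_le_sum (f := fun t => if s + t ≤ m then ∫ q in halfPlane, pd s t u q ^ 2 else 0)
        (fun t _ => h0 s t) (Finset.mem_range.mpr (by omega))
    _ ≤ _ :=
      Finset.single_le_sum (f := fun s => ∑ t ∈ Finset.range (m + 1),
          if s + t ≤ m then ∫ q in halfPlane, pd s t u q ^ 2 else 0)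
        (fun s _ => Finset.sum_nonneg fun t _ => h0 s t) (Finset.mem_range.mpr (by omega))

lemma eLpNorm_pd_two_le (hu : ContDiff ℝ m u) {s t : ℕ} (h : s + t ≤ m)
    (hi : IntegrableOn (fun q => pd s t u q ^ 2) halfPlane) :
    eLpNorm (pd s t u) 2 halfPlaneMeasure ≤
      ENNReal.ofReal (Real.sqrt (sobNormSq m halfPlane u)) := by
  rw [IntegrableOn, volume_restrict_halfPlane] at hi
  have hm := (continuous_pd hu h).aestronglyMeasurable (μ := halfPlaneMeasure)
  rw [← memLp_two_iff_integrable_sq hm] at hi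
  rw [← ENNReal.ofReal_toReal hi.2.ne, ← sqrt_integral_sq hm, ← volume_restrict_halfPlane]
  exact ENNReal.ofReal_le_ofReal (Real.sqrt_le_sqrt (integral_pd_sq_le_sobNormSq u h))

lemma eLpNorm_pd_mul_two_le {a b : ℝ → ℝ} (ha : ContDiff ℝ m a) (hb : ContDiff ℝ m b)
    (hu : ContDiff ℝ m u) {D : ℝ} (hD : 0 ≤ D) (hDa : ∀ j ≤ m, ∀ x, |iteratedDeriv j a x| ≤ D)
    (hDb : ∀ j ≤ m, ∀ x, |iteratedDeriv j b x| ≤ D)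
    (hi : ∀ s t : ℕ, s + t ≤ m → IntegrableOn (fun q => pd s t u q ^ 2) halfPlane)
    {s t : ℕ} (h : s + t ≤ m) :
    eLpNorm (pd s t fun q => a q.1 * (b q.2 * u q)) 2 halfPlaneMeasure ≤
      ENNReal.ofReal ((2 ^ m * D) ^ 2 * ((m + 1) ^ 2 * Real.sqrt (sobNormSq m halfPlane u))) := by
  set M := Real.sqrt (sobNormSq m halfPlane u)
  set S := Finset.range (s + 1) ×ˢ Finset.range (t + 1)
  have hcont : ∀ c ∈ S, Continuous fun q => |pd (s - c.1) (t - c.2) u q| := fun c _ =>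
    (continuous_pd hu (by omega)).abs
  calc _ ≤ eLpNorm ((2 ^ m * D) ^ 2 • ∑ c ∈ S, fun q => |pd (s - c.1) (t - c.2) u q|) 2
        halfPlaneMeasure := by
        refine eLpNorm_mono_real fun q => ?_
        simpa using abs_pd_mul_le ha hb hu hD hDa hDb h q
    _ ≤ ENNReal.ofReal ((2 ^ m * D) ^ 2) * ∑ c ∈ S, ENNReal.ofReal M := by
      rw [eLpNorm_const_smul, Real.enorm_of_nonneg (by positivity)]
      gcongr
      refine (eLpNorm_sum_le (fun c hc => (hcont c hc).aestronglyMeasurable) (by norm_num)).trans ?_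
      refine Finset.sum_le_sum fun c _ => ?_
      refine (eLpNorm_norm (pd (s - c.1) (t - c.2) u)).le.trans ?_
      exact eLpNorm_pd_two_le hu (by omega) (hi _ _ (by omega))
    _ ≤ _ := by
      rw [Finset.sum_const, nsmul_eq_mul, ENNReal.ofReal_mul (by positivity)]
      gcongr
      rw [← ENNReal.ofReal_natCast, ← ENNReal.ofReal_mul (by positivity)]
      refine ENNReal.ofReal_le_ofReal ?_
      gcongr
      rw [Finset.card_product, Finset.card_range, Finset.card_range]
      have : (s + 1) * (t + 1) ≤ (m + 1) ^ 2 := by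
        rw [sq]; exact Nat.mul_le_mul (by omega) (by omega)
      exact_mod_cast this

end

/-- Gagliardo–Nirenberg inequality on the half-plane. -/
lemma exists_eLpNorm_pd_pow_le {m : ℕ} (hm : m ≠ 0) : ∃ K : ℝ, 0 ≤ K ∧
    ∀ (u : ℝ × ℝ → ℝ) (B : ℝ), ContDiff ℝ m u → (∀ q ∈ halfPlane, |u q| ≤ B) →
      (∀ s t : ℕ, s + t ≤ m → IntegrableOn (fun q => pd s t u q ^ 2) halfPlane) →
      ∀ s t : ℕ, s + t ≤ m →
        eLpNorm (pd s t u) (gnExp m (s + t)) halfPlaneMeasure ^ m ≤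
          ENNReal.ofReal (K * (B ^ (m - (s + t)) *
            Real.sqrt (sobNormSq m halfPlane u) ^ (s + t))) := by
  obtain ⟨K, hK, hGN⟩ := exists_gnNorm_pow_le m
  obtain ⟨D, hD, φ, hφ, hφc, hφ1, hφe, hφD⟩ := exists_cutoff m
  set L : ℝ := 1 + (m + 1) * ((2 ^ m * D) ^ 2 * (m + 1) ^ 2) with hL
  have hL1 : 1 ≤ L := le_add_of_nonneg_right (by positivity)
  refine ⟨K * L ^ m, by positivity, fun u B hu hB hi s t hst => ?_⟩
  set M := Real.sqrt (sobNormSq m halfPlane u)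
  have hM : 0 ≤ M := Real.sqrt_nonneg _
  have hB0 : 0 ≤ B := (abs_nonneg _).trans (hB (0, 0) (by simp [halfPlane]))
  let U : ℕ → ℝ × ℝ → ℝ := fun n q => φ n q.1 * (φ n q.2 * u q)
  have hU : ∀ n, ContDiff ℝ m (U n) := fun n =>
    ((hφ n).comp contDiff_fst).mul (((hφ n).comp contDiff_snd).mul hu)
  have hUc : ∀ n, HasCompactSupport (U n) := fun n => by
    refine .intro ((hφc n).isCompact.prod (hφc n).isCompact) fun q hq => ?_
    rw [mem_prod, not_and_or] at hq
    rcases hq with h | h <;> simp [U, image_eq_zero_of_notMem_tsupport h]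
  have h0 : ∀ n, gnNorm m 0 (U n) ≤ B := fun n => by
    rw [gnNorm, Finset.Nat.antidiagonal_zero, Finset.sum_singleton, pd_zero_zero, gnExp_zero,
      eLpNorm_exponent_top]
    refine ENNReal.toReal_le_of_le_ofReal hB0 (eLpNormEssSup_le_of_ae_bound ?_)
    rw [← volume_restrict_halfPlane]
    filter_upwards [ae_restrict_mem measurableSet_halfPlane] with q hq
    rw [Real.norm_eq_abs, abs_mul, abs_mul]
    calc _ ≤ 1 * (1 * B) := by
          gcongr
          · exact hφ1 _ _
          · exact hφ1 _ _
          · exact hB q hq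
      _ = B := by ring
  have hm' : ∀ n, gnNorm m m (U n) ≤ L * M := fun n => by
    have hle : ∀ a ∈ Finset.HasAntidiagonal.antidiagonal m,
        (eLpNorm (pd a.1 a.2 (U n)) (gnExp m m) halfPlaneMeasure).toReal ≤
          (2 ^ m * D) ^ 2 * ((m + 1) ^ 2 * M) := fun a ha => by
      rw [gnExp_self hm]
      refine ENNReal.toReal_le_of_le_ofReal (by positivity) ?_
      exact eLpNorm_pd_mul_two_le (hφ n) (hφ n) hu hD (hφD n) (hφD n) hi
        (Finset.HasAntidiagonal.mem_antidiagonal.mp ha).le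
    refine (Finset.sum_le_card_nsmul _ _ _ hle).trans ?_
    rw [Finset.Nat.card_antidiagonal, nsmul_eq_mul, hL]
    push_cast
    nlinarith
  have hbound : ∀ n, eLpNorm (pd s t (U n)) (gnExp m (s + t)) halfPlaneMeasure ^ m ≤
      ENNReal.ofReal (K * L ^ m * (B ^ (m - (s + t)) * M ^ (s + t))) := fun n => by
    have hfin := eLpNorm_halfPlane_ne_top (continuous_pd (hU n) hst)
      (hasCompactSupport_pd (hU n) (hUc n) hst) (gnExp m (s + t))
    rw [← ENNReal.ofReal_toReal hfin, ← ENNReal.ofReal_pow ENNReal.toReal_nonneg]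
    refine ENNReal.ofReal_le_ofReal ?_
    calc _ ≤ gnNorm m (s + t) (U n) ^ m :=
          pow_le_pow_left₀ ENNReal.toReal_nonneg (toReal_eLpNorm_pd_le_gnNorm m s t _) _
      _ ≤ K * (gnNorm m 0 (U n) ^ (m - (s + t)) * gnNorm m m (U n) ^ (s + t)) :=
          hGN _ (hU n) (hUc n) _ hst
      _ ≤ K * (B ^ (m - (s + t)) * (L * M) ^ (s + t)) := by
          have g0 := gnNorm_nonneg m 0 (U n)
          have g1 := gnNorm_nonneg m m (U n)
          gcongr
          · exact h0 n
          · exact hm' n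
      _ = K * L ^ (s + t) * (B ^ (m - (s + t)) * M ^ (s + t)) := by rw [mul_pow]; ring
      _ ≤ _ := by
          gcongr
  have hlim : eLpNorm (pd s t u) (gnExp m (s + t)) halfPlaneMeasure ≤
      ENNReal.ofReal (K * L ^ m * (B ^ (m - (s + t)) * M ^ (s + t))) ^ (m : ℝ)⁻¹ := by
    refine (Lp.eLpNorm_lim_le_liminf_eLpNorm
      (fun n => (continuous_pd (hU n) hst).aestronglyMeasurable) _
      (.of_forall fun q => ?_)).trans ?_
    · refine tendsto_const_nhds.congr' ?_
      filter_upwards [hφe q.1, hφe q.2] with n h1 h2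
      exact (pd_congr_of_eventuallyEq_one h1 h2 s t).symm
    · refine Filter.liminf_le_of_frequently_le' (.of_forall fun n => ?_)
      rw [ENNReal.le_rpow_inv_iff (by positivity), ENNReal.rpow_natCast]
      exact hbound n
  rwa [ENNReal.le_rpow_inv_iff (by positivity), ENNReal.rpow_natCast] at hlim

lemma prod_pow_mul_pow_le {ι : Type*} [Fintype ι] [DecidableEq ι] {m : ℕ} {B M : ι → ℝ}
    {k : ι → ℕ} (hB : ∀ i, 0 ≤ B i) (hM : ∀ i, 0 ≤ M i) (hk : ∑ i, k i = m) :
    ∏ i, (B i ^ (m - k i) * M i ^ k i) ≤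
      (∑ j, (∏ i ∈ Finset.univ.erase j, B i) * M j) ^ m := by
  have hP : ∀ j, 0 ≤ ∏ i ∈ Finset.univ.erase j, B i := fun j => Finset.prod_nonneg fun i _ => hB i
  have hX : ∀ j, 0 ≤ (∏ i ∈ Finset.univ.erase j, B i) * M j := fun j => mul_nonneg (hP j) (hM j)
  calc ∏ i, (B i ^ (m - k i) * M i ^ k i)
      = ∏ j, ((∏ i ∈ Finset.univ.erase j, B i) * M j) ^ k j := by
        simp_rw [mul_pow, Finset.prod_mul_distrib, ← Finset.prod_pow]
        congr 1
        rw [Finset.prod_comm' (t' := Finset.univ) (s' := fun i => Finset.univ.erase i)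
          (by simp [eq_comm])]
        refine Finset.prod_congr rfl fun i _ => ?_
        rw [Finset.prod_pow_eq_pow_sum, ← hk, ← Finset.add_sum_erase _ k (Finset.mem_univ i),
          Nat.add_sub_cancel_left]
    _ ≤ ∏ j, (∑ j, (∏ i ∈ Finset.univ.erase j, B i) * M j) ^ k j := by
        refine Finset.prod_le_prod (fun j _ => pow_nonneg (hX j) _) fun j _ => ?_
        exact pow_le_pow_left₀ (hX j)
          (Finset.single_le_sum (fun j _ => hX j) (Finset.mem_univ j)) _
    _ = _ := by rw [Finset.prod_pow_eq_pow_sum, hk]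

lemma sqrt_integral_prod_sq_le {ι : Type*} [Fintype ι] [DecidableEq ι] {u : ι → ℝ × ℝ → ℝ}
    {B : ι → ℝ} (j : ι) (hB : ∀ i, ∀ q ∈ halfPlane, |u i q| ≤ B i)
    (hi : IntegrableOn (fun q => u j q ^ 2) halfPlane) :
    Real.sqrt (∫ q in halfPlane, (∏ i, u i q) ^ 2) ≤
      (∏ i ∈ Finset.univ.erase j, B i) * Real.sqrt (∫ q in halfPlane, u j q ^ 2) := by
  have hB0 : ∀ i, 0 ≤ B i := fun i => (abs_nonneg _).trans (hB i (0, 0) (by simp [halfPlane]))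
  have hP : 0 ≤ ∏ i ∈ Finset.univ.erase j, B i := Finset.prod_nonneg fun i _ => hB0 i
  rw [← Real.sqrt_sq hP, ← Real.sqrt_mul (sq_nonneg _), ← integral_const_mul]
  refine Real.sqrt_le_sqrt (integral_mono_of_nonneg (.of_forall fun _ => sq_nonneg _)
    (hi.const_mul _) ?_)
  filter_upwards [ae_restrict_mem measurableSet_halfPlane] with q hq
  rw [← Finset.mul_prod_erase _ _ (Finset.mem_univ j), mul_pow, mul_comm]
  refine mul_le_mul_of_nonneg_right ?_ (sq_nonneg _)
  rw [← sq_abs, Finset.abs_prod]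
  exact pow_le_pow_left₀ (Finset.prod_nonneg fun i _ => abs_nonneg _)
    (Finset.prod_le_prod (fun i _ => abs_nonneg _) fun i _ => hB i q hq) 2

/-- Lemma 3.3(i) of the paper (Gagliardo–Nirenberg product estimate): if
`|α₁| + ⋯ + |α_l| = m`, then `‖∂^{α₁}u₁ ⋯ ∂^{α_l}u_l‖_{L²(ℝ²₊)} ≤
C Σ_j (Π_{i≠j} ‖u_i‖_∞) ‖u_j‖_{H^m}`, with `C = C(l,m)`. -/
theorem stmt_8 (l m : ℕ) :
    ∃ C > (0:ℝ), ∀ (u : Fin l → ℝ × ℝ → ℝ) (B : Fin l → ℝ) (α : Fin l → ℕ × ℕ),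
      (∑ i, ((α i).1 + (α i).2)) = m →
      (∀ i, ContDiff ℝ (m : ℕ∞) (u i)) →
      (∀ i, ∀ q ∈ halfPlane, |u i q| ≤ B i) →
      (∀ i, ∀ s t : ℕ, s + t ≤ m →
        IntegrableOn (fun q => (pd s t (u i) q) ^ 2) halfPlane volume) →
      Real.sqrt (∫ q in halfPlane, (∏ i, pd (α i).1 (α i).2 (u i) q) ^ 2)
        ≤ C * ∑ j, (∏ i ∈ Finset.univ.erase j, B i) *
            Real.sqrt (sobNormSq m halfPlane (u j)) := by
  rcases eq_or_ne m 0 with rfl | hm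
  · refine ⟨1, one_pos, fun u B α hα _ hB hi => ?_⟩
    have hα0 : ∀ i, α i = (0, 0) := fun i => by
      have := Finset.sum_eq_zero_iff.mp hα i (Finset.mem_univ i)
      exact Prod.ext (by simp; omega) (by simp; omega)
    have hB0 : ∀ i, 0 ≤ B i := fun i => (abs_nonneg _).trans (hB i (0, 0) (by simp [halfPlane]))
    simp only [hα0, one_mul, pd_zero_zero]
    rcases isEmpty_or_nonempty (Fin l) with hl | ⟨⟨j⟩⟩
    · have : volume.restrict halfPlane univ = ∞ := by
        simp [volume_restrict_halfPlane, halfPlaneMeasure, ← univ_prod_univ, Measure.prod_prod]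
      simp [measureReal_def] at this ⊢
      simp [this]
    · refine (sqrt_integral_prod_sq_le j hB
        (by simpa [pd_zero_zero] using hi j 0 0 le_rfl)).trans ?_
      refine le_trans (le_of_eq ?_) (Finset.single_le_sum (fun j _ =>
        mul_nonneg (Finset.prod_nonneg fun i _ => hB0 i) (Real.sqrt_nonneg _)) (Finset.mem_univ j))
      simp [sobNormSq, pd_zero_zero]
  · obtain ⟨K, hK, hGN⟩ := exists_eLpNorm_pd_pow_le hm
    refine ⟨(K + 1) ^ l, by positivity, fun u B α hα hu hB hi => ?_⟩
    have hB0 : ∀ i, 0 ≤ B i := fun i => (abs_nonneg _).trans (hB i (0, 0) (by simp [halfPlane]))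
    have hα' : ∀ i, (α i).1 + (α i).2 ≤ m := fun i =>
      hα ▸ Finset.single_le_sum (f := fun i => (α i).1 + (α i).2) (fun _ _ => Nat.zero_le _)
        (Finset.mem_univ i)
    have hc : ∀ i, Continuous (pd (α i).1 (α i).2 (u i)) := fun i => continuous_pd (hu i) (hα' i)
    set S := ∑ j, (∏ i ∈ Finset.univ.erase j, B i) * Real.sqrt (sobNormSq m halfPlane (u j))
    have hS : 0 ≤ S := Finset.sum_nonneg fun j _ =>
      mul_nonneg (Finset.prod_nonneg fun i _ => hB0 i) (Real.sqrt_nonneg _)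
    have hsum : (∑ i, (gnExp m ((α i).1 + (α i).2))⁻¹)⁻¹ = 2 := by
      rw [← gnExp_self hm]
      simp only [gnExp, inv_inv]
      rw [← ENNReal.ofReal_sum_of_nonneg fun i _ => by positivity, ← Finset.sum_div,
        ← Nat.cast_sum, hα]
    have hprod := eLpNorm_prod_le (μ := halfPlaneMeasure) Finset.univ
      (f := fun i => pd (α i).1 (α i).2 (u i)) (fun i _ => (hc i).aestronglyMeasurable)
      (fun i => gnExp m ((α i).1 + (α i).2))
    rw [hsum] at hprod
    have hpow : eLpNorm (∏ i, pd (α i).1 (α i).2 (u i)) 2 halfPlaneMeasure ^ m ≤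
        ENNReal.ofReal ((K + 1) ^ l * S) ^ m := by
      refine (pow_le_pow_left' hprod m).trans ?_
      rw [← Finset.prod_pow]
      refine (Finset.prod_le_prod' fun i _ =>
        hGN (u i) (B i) (hu i) (hB i) (hi i) _ _ (hα' i)).trans ?_
      rw [← ENNReal.ofReal_prod_of_nonneg fun i _ => mul_nonneg hK
        (mul_nonneg (pow_nonneg (hB0 i) _) (pow_nonneg (Real.sqrt_nonneg _) _)),
        ← ENNReal.ofReal_pow (by positivity)]
      refine ENNReal.ofReal_le_ofReal ?_
      rw [Finset.prod_mul_distrib, Finset.prod_const, Finset.card_univ, Fintype.card_fin, mul_pow]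
      gcongr
      · exact Finset.prod_nonneg fun i _ =>
          mul_nonneg (pow_nonneg (hB0 i) _) (pow_nonneg (Real.sqrt_nonneg _) _)
      · refine (pow_le_pow_left₀ hK (by linarith : K ≤ K + 1) l).trans ?_
        exact le_self_pow₀ (one_le_pow₀ (by linarith)) hm
      · exact prod_pow_mul_pow_le hB0 (fun _ => Real.sqrt_nonneg _) hα
    have hle := (ENNReal.pow_le_pow_left_iff hm).mp hpow
    have hP : Continuous fun q => ∏ i, pd (α i).1 (α i).2 (u i) q :=
      continuous_finsetProd _ fun i _ => hc i
    rw [volume_restrict_halfPlane, sqrt_integral_sq hP.aestronglyMeasurable]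
    refine ENNReal.toReal_le_of_le_ofReal (by positivity) ?_
    rwa [← Finset.prod_fn]
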